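/- arXiv:2406.18874 — 4 statements merged into one kernel-verified Lean document; each statement's English description precedes it below -/
import Mathlib

section
/- Let A₁, A₂, A₃ ∈ U₂ satisfy rank(Aᵢ − Aⱼ) = 2 for all i ≠ j. Then exactly one of the following holds: (a) there exists an automorphism Φ of U₂ with Φ(A₁) = −I, Φ(A₂) = I, and Φ(A₃) = −i·I (the triple is in a timelike position); (b) there exists an automorphism Φ of U₂ with Φ(A₁) = −I, Φ(A₂) = I, and Φ(A₃) = −i·J, where J = diag(1, −1) (the triple is in a spacelike position). -/
open Matrix
open scoped ComplexOrder

noncomputable section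

/-- The space of `2×2` complex matrices. -/
abbrev Mat2 : Type := Matrix (Fin 2) (Fin 2) ℂ

/-- The group of `2×2` complex unitary matrices. -/
abbrev U2 : Type := Matrix.unitaryGroup (Fin 2) ℂ

/-- Coherency for matrices: `A ∼ B` iff `rank (A − B) ≤ 1`. -/
def Coherent (A B : Mat2) : Prop := (A - B).rank ≤ 1

/-- Coherency for unitaries: `U ∼ V` iff `rank (U − V) ≤ 1`. -/
def CoherentU (U V : U2) : Prop := ((U : Mat2) - (V : Mat2)).rank ≤ 1

/-- The Cayley transform, as a matrix: `𝔠(A) = (A − iI)(A + iI)⁻¹`. -/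
def cayleyMat (A : Mat2) : Mat2 :=
  (A - Complex.I • (1 : Mat2)) * (A + Complex.I • (1 : Mat2))⁻¹

open Classical in
/-- The Cayley transform, landing in the unitary group.  For every hermitian `A` the matrix
`cayleyMat A` is unitary, so the junk value `1` is never used for the matrices considered here. -/
def cayley (A : Mat2) : U2 :=
  if h : cayleyMat A ∈ Matrix.unitaryGroup (Fin 2) ℂ then ⟨cayleyMat A, h⟩ else 1

/-- An automorphism of `U₂`: a bijection preserving coherency in both directions. -/
def IsAut (Φ : U2 → U2) : Prop :=
  Function.Bijective Φ ∧ ∀ U V : U2, CoherentU U V ↔ CoherentU (Φ U) (Φ V)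

/-- A line in `U₂`: a maximal subset all of whose elements are pairwise coherent. -/
def IsLine (ℓ : Set U2) : Prop :=
  (∀ U ∈ ℓ, ∀ V ∈ ℓ, CoherentU U V) ∧
  ∀ m : Set U2, ℓ ⊆ m → (∀ U ∈ m, ∀ V ∈ m, CoherentU U V) → m = ℓ

/-- The matrix interval `[A, B] = {X : A ≤ X ≤ B}` (in the Loewner order). -/
def matIcc (A B : Mat2) : Set Mat2 := {X | (X - A).PosSemidef ∧ (B - X).PosSemidef}

/-- Rank one projections: `P = P* = P²` of rank one. -/
def IsProj1 (P : Mat2) : Prop := P.IsHermitian ∧ P * P = P ∧ P.rank = 1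

/-- The matrix `J = diag(1, −1)`. -/
def Jmat : Mat2 := Matrix.diagonal ![1, -1]

theorem rank_le_one_iff_det_eq_zero (A : Mat2) : A.rank ≤ 1 ↔ A.det = 0 := by
  constructor
  · intro h
    by_contra hd
    have := A.rank_of_isUnit ((A.isUnit_iff_isUnit_det).2 (isUnit_iff_ne_zero.2 hd))
    simp at this
    omega
  · intro h
    obtain ⟨v, hv, hAv⟩ := Matrix.exists_mulVec_eq_zero_iff.2 h
    have hlt : A.rank < 2 := by
      by_contra hge
      have hr : A.rank = 2 := le_antisymm (by simpa using A.rank_le_card_width) (not_lt.1 hge)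
      have hsurj : Function.Surjective A.mulVecLin := by
        rw [← LinearMap.range_eq_top]
        apply Submodule.eq_top_of_finrank_eq
        simpa [Matrix.rank] using hr
      exact hv (LinearMap.injective_iff_surjective.2 hsurj (by simpa using hAv))
    omega

theorem coherentU_iff_det_eq_zero (U V : U2) :
    CoherentU U V ↔ ((U : Mat2) - (V : Mat2)).det = 0 :=
  rank_le_one_iff_det_eq_zero _

theorem conjTranspose_mul_self_of_U2 (U : U2) : (U : Mat2)ᴴ * (U : Mat2) = 1 :=
  Matrix.mem_unitaryGroup_iff'.1 U.2

theorem mul_conjTranspose_self_of_U2 (U : U2) : (U : Mat2) * (U : Mat2)ᴴ = 1 :=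
  Matrix.mem_unitaryGroup_iff.1 U.2

theorem coherentU_iff_det_conjTranspose_mul (U V : U2) :
    CoherentU U V ↔ ((V : Mat2)ᴴ * (U : Mat2) - 1).det = 0 := by
  have hV := conjTranspose_mul_self_of_U2 V
  have hdet : (V : Mat2)ᴴ.det ≠ 0 := by
    intro h
    simpa [h] using congrArg Matrix.det hV
  rw [coherentU_iff_det_eq_zero, ← hV, ← mul_sub, Matrix.det_mul, mul_eq_zero]
  simp only [hdet, false_or]

/-- The block matrix `[[P, Q], [R, S]]` preserves the hermitian form of signature `(2, 2)`. -/
structure IsPseudoUnitary (P Q R S : Mat2) : Prop where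
  left : Pᴴ * P - Rᴴ * R = 1
  right : Sᴴ * S - Qᴴ * Q = 1
  cross : Pᴴ * Q = Rᴴ * S

namespace IsPseudoUnitary

variable {P Q R S : Mat2}

theorem cross' (h : IsPseudoUnitary P Q R S) : Qᴴ * P = Sᴴ * R := by
  simpa using congrArg Matrix.conjTranspose h.cross

theorem form_eq (h : IsPseudoUnitary P Q R S) (U V : Mat2) :
    (P * V + Q)ᴴ * (P * U + Q) - (R * V + S)ᴴ * (R * U + S) = Vᴴ * U - 1 := by
  calc (P * V + Q)ᴴ * (P * U + Q) - (R * V + S)ᴴ * (R * U + S)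
      = Vᴴ * (Pᴴ * P - Rᴴ * R) * U + Vᴴ * (Pᴴ * Q - Rᴴ * S) + (Qᴴ * P - Sᴴ * R) * U
          - (Sᴴ * S - Qᴴ * Q) := by
        simp only [Matrix.conjTranspose_add, Matrix.conjTranspose_mul]
        noncomm_ring
    _ = Vᴴ * U - 1 := by
        rw [h.left, h.right, h.cross, h.cross']
        simp

theorem isUnit_denominator (h : IsPseudoUnitary P Q R S) (U : U2) :
    IsUnit (R * (U : Mat2) + S) := by
  rw [Matrix.isUnit_iff_isUnit_det, isUnit_iff_ne_zero]
  intro hdet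
  obtain ⟨v, hv, hDv⟩ := Matrix.exists_mulVec_eq_zero_iff.2 hdet
  have hform := h.form_eq U U
  rw [conjTranspose_mul_self_of_U2, sub_self, sub_eq_zero] at hform
  have hNv : (P * (U : Mat2) + Q) *ᵥ v = 0 := by
    rw [← Matrix.conjTranspose_mul_self_mulVec_eq_zero, hform, ← Matrix.mulVec_mulVec, hDv,
      Matrix.mulVec_zero]
  have hU : Pᴴ * (P * (U : Mat2) + Q) - Rᴴ * (R * (U : Mat2) + S) = U := by
    calc _ = (Pᴴ * P - Rᴴ * R) * (U : Mat2) + (Pᴴ * Q - Rᴴ * S) := by noncomm_ring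
      _ = U := by rw [h.left, h.cross]; simp
  have hUv : (U : Mat2) *ᵥ v = 0 := by
    rw [← hU, Matrix.sub_mulVec, ← Matrix.mulVec_mulVec, ← Matrix.mulVec_mulVec, hDv, hNv]
    simp
  apply hv
  rw [← Matrix.one_mulVec v, ← conjTranspose_mul_self_of_U2 U, ← Matrix.mulVec_mulVec, hUv,
    Matrix.mulVec_zero]

theorem exists_map (h : IsPseudoUnitary P Q R S) (U : U2) :
    ∃ W : U2, (W : Mat2) * (R * (U : Mat2) + S) = P * (U : Mat2) + Q := by
  have hD := h.isUnit_denominator U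
  have hdet := (Matrix.isUnit_iff_isUnit_det _).1 hD
  have hform := h.form_eq U U
  rw [conjTranspose_mul_self_of_U2, sub_self, sub_eq_zero] at hform
  refine ⟨⟨(P * (U : Mat2) + Q) * (R * (U : Mat2) + S)⁻¹, ?_⟩, ?_⟩
  · rw [Matrix.mem_unitaryGroup_iff', Matrix.star_eq_conjTranspose, Matrix.conjTranspose_mul,
      Matrix.mul_assoc, ← Matrix.mul_assoc _ (P * (U : Mat2) + Q), hform,
      Matrix.mul_assoc, Matrix.mul_nonsing_inv _ hdet, Matrix.mul_one,
      ← Matrix.conjTranspose_mul, Matrix.mul_nonsing_inv _ hdet, Matrix.conjTranspose_one]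
  · exact Matrix.nonsing_inv_mul_cancel_right _ _ hdet

/-- The inverse of a pseudo-unitary block matrix is pseudo-unitary. -/
theorem inverse (h : IsPseudoUnitary P Q R S) : IsPseudoUnitary Pᴴ (-Rᴴ) (-Qᴴ) Sᴴ := by
  have hinv : Matrix.fromBlocks Pᴴ (-Rᴴ) (-Qᴴ) Sᴴ * Matrix.fromBlocks P Q R S = 1 := by
    rw [Matrix.fromBlocks_multiply, ← Matrix.fromBlocks_one]
    congr 1
    · rw [← h.left]; noncomm_ring
    · rw [h.cross]; noncomm_ring
    · rw [neg_mul, h.cross', neg_add_cancel]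
    · rw [← h.right]; noncomm_ring
  rw [mul_eq_one_comm, Matrix.fromBlocks_multiply, ← Matrix.fromBlocks_one,
    Matrix.fromBlocks_inj] at hinv
  obtain ⟨hl, hc, -, hr⟩ := hinv
  refine ⟨?_, ?_, ?_⟩
  · rw [← hl]; simp [sub_eq_add_neg]
  · rw [← hr]; simp [add_comm, sub_eq_add_neg]
  · rw [← sub_eq_zero, ← neg_eq_zero, ← neg_eq_zero, ← hc]; simp

theorem exists_preimage (h : IsPseudoUnitary P Q R S) (W : U2) :
    ∃ U : U2, (W : Mat2) * (R * (U : Mat2) + S) = P * (U : Mat2) + Q := by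
  obtain ⟨U, hU⟩ := h.inverse.exists_map W
  have hi := h.inverse
  refine ⟨U, (h.inverse.isUnit_denominator W).mul_left_injective ?_⟩
  have hc := hi.cross
  have hc' := hi.cross'
  have hl := hi.left
  have hr := hi.right
  simp only [Matrix.conjTranspose_neg, Matrix.conjTranspose_conjTranspose, neg_mul, mul_neg,
    neg_neg, neg_inj] at hc hc' hl hr
  show (W : Mat2) * (R * (U : Mat2) + S) * (-Qᴴ * (W : Mat2) + Sᴴ) =
    (P * (U : Mat2) + Q) * (-Qᴴ * (W : Mat2) + Sᴴ)
  have h1 : (R * (U : Mat2) + S) * (-Qᴴ * (W : Mat2) + Sᴴ) = 1 := by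
    calc _ = R * ((U : Mat2) * (-Qᴴ * (W : Mat2) + Sᴴ)) + S * (-Qᴴ * (W : Mat2) + Sᴴ) := by
          noncomm_ring
      _ = (R * Pᴴ - S * Qᴴ) * (W : Mat2) + (S * Sᴴ - R * Rᴴ) := by rw [hU]; noncomm_ring
      _ = 1 := by rw [hr, hc']; simp
  have h2 : (P * (U : Mat2) + Q) * (-Qᴴ * (W : Mat2) + Sᴴ) = W := by
    calc _ = P * ((U : Mat2) * (-Qᴴ * (W : Mat2) + Sᴴ)) + Q * (-Qᴴ * (W : Mat2) + Sᴴ) := by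
          noncomm_ring
      _ = (P * Pᴴ - Q * Qᴴ) * (W : Mat2) + (Q * Sᴴ - P * Rᴴ) := by rw [hU]; noncomm_ring
      _ = W := by rw [hl, hc]; simp
  rw [Matrix.mul_assoc, h1, h2, Matrix.mul_one]

/-- A pseudo-unitary block matrix acts on `U₂` by the automorphism
`U ↦ (P U + Q) (R U + S)⁻¹`. -/
theorem exists_isAut (h : IsPseudoUnitary P Q R S) :
    ∃ Φ : U2 → U2, IsAut Φ ∧ ∀ U W : U2,
      (W : Mat2) * (R * (U : Mat2) + S) = P * (U : Mat2) + Q → Φ U = W := by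
  choose Φ hΦ using h.exists_map
  have key (U V : U2) : (R * (V : Mat2) + S)ᴴ * ((Φ V : Mat2)ᴴ * (Φ U : Mat2) - 1) *
      (R * (U : Mat2) + S) = (V : Mat2)ᴴ * (U : Mat2) - 1 := by
    rw [← h.form_eq (U : Mat2), ← hΦ U, ← hΦ V, Matrix.conjTranspose_mul]
    noncomm_ring
  have huniq (U W : U2) (hW : (W : Mat2) * (R * (U : Mat2) + S) = P * (U : Mat2) + Q) :
      Φ U = W :=
    Subtype.ext ((h.isUnit_denominator U).mul_left_injective ((hΦ U).trans hW.symm))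
  refine ⟨Φ, ⟨⟨fun U V hUV => ?_, fun W => ?_⟩, fun U V => ?_⟩, huniq⟩
  · have hk := key U V
    rw [hUV, conjTranspose_mul_self_of_U2, sub_self, mul_zero, zero_mul] at hk
    apply Subtype.ext
    rw [← Matrix.one_mul (U : Mat2), ← mul_conjTranspose_self_of_U2 V, Matrix.mul_assoc,
      sub_eq_zero.1 hk.symm, Matrix.mul_one]
  · obtain ⟨U, hU⟩ := h.exists_preimage W
    exact ⟨U, huniq U W hU⟩
  · have hDU := (Matrix.isUnit_iff_isUnit_det _).1 (h.isUnit_denominator U)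
    have hDV := (Matrix.isUnit_iff_isUnit_det _).1 (h.isUnit_denominator V)
    rw [coherentU_iff_det_conjTranspose_mul, coherentU_iff_det_conjTranspose_mul, ← key U V,
      Matrix.det_mul, Matrix.det_mul, Matrix.det_conjTranspose]
    simp [hDU.ne_zero, hDV.ne_zero]

end IsPseudoUnitary

theorem isPseudoUnitary_of_frame {X Y C D : Mat2} (hC : Cᴴ * C = Xᴴ * X) (hD : Dᴴ * D = Yᴴ * Y)
    (hDC : Dᴴ * C = Yᴴ * X - 2) :
    IsPseudoUnitary ((1 / 2 : ℂ) • (D - C)) ((1 / 2 : ℂ) • (D + C))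
      ((1 / 2 : ℂ) • (Y - X)) ((1 / 2 : ℂ) • (Y + X)) := by
  have hCD : Cᴴ * D = Xᴴ * Y - 2 := by
    simpa using congrArg Matrix.conjTranspose hDC
  have two_eq : (2 : Mat2) = (2 : ℂ) • 1 := by
    rw [two_smul, one_add_one_eq_two]
  constructor <;>
  · simp only [Matrix.conjTranspose_smul, Matrix.conjTranspose_sub, Matrix.conjTranspose_add,
      Matrix.smul_mul, Matrix.mul_smul, sub_mul, mul_sub, add_mul, mul_add, hC, hD,
      hDC, hCD, two_eq, star_div₀, star_one, star_ofNat]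
    module

/-- The fractional linear automorphism sending `-1` to `A` and `1` to `B` that is attached to a
choice of bases `X`, `Y`. -/
theorem exists_isAut_of_frame (A B : U2) {X Y : Mat2}
    (h : Yᴴ * (1 - (B : Mat2)ᴴ * (A : Mat2)) * X = 2) :
    ∃ Φ : U2 → U2, IsAut Φ ∧
      (∀ U : U2, (U : Mat2) = -1 → Φ U = A) ∧ (∀ U : U2, (U : Mat2) = 1 → Φ U = B) ∧
      ∀ U W : U2,
        (W : Mat2) * (Y * (1 + (U : Mat2)) + X * (1 - (U : Mat2))) =
          (B : Mat2) * Y * (1 + (U : Mat2)) + (A : Mat2) * X * (1 - (U : Mat2)) → Φ U = W := by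
  have isometry (W : U2) (Z : Mat2) : ((W : Mat2) * Z)ᴴ * ((W : Mat2) * Z) = Zᴴ * Z := by
    rw [Matrix.conjTranspose_mul, Matrix.mul_assoc, ← Matrix.mul_assoc _ (W : Mat2),
      conjTranspose_mul_self_of_U2, Matrix.one_mul]
  have hcross : ((B : Mat2) * Y)ᴴ * ((A : Mat2) * X) = Yᴴ * X - 2 := by
    rw [← h, Matrix.conjTranspose_mul]
    noncomm_ring
  obtain ⟨Φ, hΦ, huniq⟩ :=
    (isPseudoUnitary_of_frame (isometry A X) (isometry B Y) hcross).exists_isAut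
  have hmap (U W : U2)
      (hW : (W : Mat2) * (Y * (1 + (U : Mat2)) + X * (1 - (U : Mat2))) =
          (B : Mat2) * Y * (1 + (U : Mat2)) + (A : Mat2) * X * (1 - (U : Mat2))) : Φ U = W := by
    apply huniq
    have hden : (1 / 2 : ℂ) • (Y - X) * (U : Mat2) + (1 / 2 : ℂ) • (Y + X) =
        (1 / 2 : ℂ) • (Y * (1 + (U : Mat2)) + X * (1 - (U : Mat2))) := by
      rw [Matrix.smul_mul, ← smul_add]
      congr 1
      noncomm_ring
    have hnum : (1 / 2 : ℂ) • ((B : Mat2) * Y - (A : Mat2) * X) * (U : Mat2) +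
          (1 / 2 : ℂ) • ((B : Mat2) * Y + (A : Mat2) * X) =
        (1 / 2 : ℂ) • ((B : Mat2) * Y * (1 + (U : Mat2)) +
          (A : Mat2) * X * (1 - (U : Mat2))) := by
      rw [Matrix.smul_mul, ← smul_add]
      congr 1
      noncomm_ring
    rw [hden, hnum, Matrix.mul_smul, hW]
  refine ⟨Φ, hΦ, fun U hU => hmap U A ?_, fun U hU => hmap U B ?_, hmap⟩
  · rw [hU]; noncomm_ring
  · rw [hU]; noncomm_ring

theorem IsAut.comp {Φ Ψ : U2 → U2} (hΦ : IsAut Φ) (hΨ : IsAut Ψ) : IsAut (Φ ∘ Ψ) :=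
  ⟨hΦ.1.comp hΨ.1, fun U V => (hΨ.2 U V).trans (hΦ.2 _ _)⟩

theorem IsAut.exists_inverse {Φ : U2 → U2} (hΦ : IsAut Φ) :
    ∃ Ψ : U2 → U2, IsAut Ψ ∧ ∀ U, Ψ (Φ U) = U := by
  let e := Equiv.ofBijective Φ hΦ.1
  refine ⟨e.symm, ⟨e.symm.bijective, fun U V => ?_⟩, e.symm_apply_apply⟩
  rw [hΦ.2 (e.symm U) (e.symm V)]
  exact iff_of_eq (congrArg₂ CoherentU (e.apply_symm_apply U).symm (e.apply_symm_apply V).symm)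

theorem isAut_star : IsAut (star : U2 → U2) := by
  refine ⟨star_involutive.bijective, fun U V => ?_⟩
  have h : ((star U : U2) : Mat2) - ((star V : U2) : Mat2) = ((U : Mat2) - (V : Mat2))ᴴ := by
    simp [Matrix.star_eq_conjTranspose]
  rw [CoherentU, CoherentU, h, Matrix.rank_conjTranspose]

theorem exists_isAut_of_not_coherent {A B : U2} (h : ¬ CoherentU A B) :
    ∃ Φ : U2 → U2, IsAut Φ ∧ (Φ A : Mat2) = -1 ∧ (Φ B : Mat2) = 1 := by
  rw [coherentU_iff_det_conjTranspose_mul, ← neg_sub, Matrix.det_neg] at h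
  have hunit : IsUnit (1 - (B : Mat2)ᴴ * (A : Mat2)).det := by
    rw [isUnit_iff_ne_zero]
    simpa using h
  let Z : Mat2 := 2 * (1 - (B : Mat2)ᴴ * (A : Mat2))⁻¹
  obtain ⟨Φ, hΦ, hA, hB, -⟩ := exists_isAut_of_frame A B (X := 1) (Y := Zᴴ) (by
      rw [Matrix.conjTranspose_conjTranspose, Matrix.mul_one,
        Matrix.nonsing_inv_mul_cancel_right _ _ hunit])
  obtain ⟨Ψ, hΨ, hinv⟩ := hΦ.exists_inverse
  refine ⟨Ψ, hΨ, ?_, ?_⟩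
  · rw [← hA (-1) rfl, hinv]; rfl
  · rw [← hB 1 rfl, hinv]; rfl

/-- Sylvester normal form of an invertible hermitian matrix. -/
theorem exists_congruence_of_isHermitian {H : Mat2} (hH : H.IsHermitian) (hdet : H.det ≠ 0) :
    ∃ (X Y : Mat2) (s : Fin 2 → ℂ), (∀ i, s i = 1 ∨ s i = -1) ∧ Yᴴ * X = 1 ∧
      H * X = Y * Matrix.diagonal s := by
  let V : Mat2 := hH.eigenvectorUnitary
  let d := hH.eigenvalues
  have hVV : Vᴴ * V = 1 := conjTranspose_mul_self_of_U2 hH.eigenvectorUnitary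
  have hspec : H = V * Matrix.diagonal (fun i => (d i : ℂ)) * Vᴴ := by
    have := hH.spectral_theorem
    rw [Unitary.conjStarAlgAut_apply] at this
    exact this
  have hd (i : Fin 2) : d i ≠ 0 := by
    intro hi
    apply hdet
    rw [hH.det_eq_prod_eigenvalues]
    exact Finset.prod_eq_zero (Finset.mem_univ i) (by simpa using hi)
  let r : Fin 2 → ℝ := fun i => √|d i|
  have hr (i : Fin 2) : r i ≠ 0 := (Real.sqrt_pos.2 (abs_pos.2 (hd i))).ne'
  have hrr (i : Fin 2) : r i * r i = |d i| := Real.mul_self_sqrt (abs_nonneg _)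
  refine ⟨V * Matrix.diagonal (fun i => ((r i)⁻¹ : ℂ)), V * Matrix.diagonal (fun i => (r i : ℂ)),
    fun i => ((d i / |d i| : ℝ) : ℂ), fun i => ?_, ?_, ?_⟩
  · dsimp only
    rcases lt_or_gt_of_ne (hd i) with h | h
    · right; rw [abs_of_neg h, div_neg, div_self (hd i)]; simp
    · left; rw [abs_of_pos h, div_self (hd i)]; simp
  · rw [Matrix.conjTranspose_mul, Matrix.mul_assoc, ← Matrix.mul_assoc Vᴴ, hVV, Matrix.one_mul,
      Matrix.diagonal_conjTranspose, Matrix.diagonal_mul_diagonal, ← Matrix.diagonal_one]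
    congr 1
    ext i
    simp [hr i]
  · rw [hspec, Matrix.mul_assoc, ← Matrix.mul_assoc Vᴴ, hVV, Matrix.one_mul, Matrix.mul_assoc,
      Matrix.mul_assoc, Matrix.diagonal_mul_diagonal, Matrix.diagonal_mul_diagonal]
    congr 2
    ext i
    rw [← hrr i, ← Complex.ofReal_inv, ← Complex.ofReal_mul, ← Complex.ofReal_mul]
    congr 1
    have := hr i
    field_simp

theorem neg_I_smul_diagonal_mem {s : Fin 2 → ℂ} (hs : ∀ i, s i = 1 ∨ s i = -1) :
    -(Complex.I • Matrix.diagonal s) ∈ Matrix.unitaryGroup (Fin 2) ℂ := by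
  rw [Matrix.mem_unitaryGroup_iff', Matrix.star_eq_conjTranspose]
  ext i j
  fin_cases i <;> fin_cases j <;> rcases hs 0 with h0 | h0 <;> rcases hs 1 with h1 | h1 <;>
    simp [Matrix.mul_apply, h0, h1]

/-- Automorphisms fixing `-1` and `1` bring the third point to a diagonal normal form. -/
theorem exists_isAut_diagonal {A B W : U2} (hA : (A : Mat2) = -1) (hB : (B : Mat2) = 1)
    (hAW : ¬ CoherentU A W) (hBW : ¬ CoherentU B W) :
    ∃ (Φ : U2 → U2) (s : Fin 2 → ℂ), IsAut Φ ∧ (∀ i, s i = 1 ∨ s i = -1) ∧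
      Φ A = A ∧ Φ B = B ∧ (Φ W : Mat2) = -(Complex.I • Matrix.diagonal s) := by
  have hminus : IsUnit (1 - (W : Mat2)).det := by
    rw [isUnit_iff_ne_zero]
    rwa [coherentU_iff_det_eq_zero, hB] at hBW
  have hplus : (1 + (W : Mat2)).det ≠ 0 := by
    rw [coherentU_iff_det_eq_zero, hA, ← neg_add', Matrix.det_neg] at hAW
    simpa using hAW
  let H : Mat2 := Complex.I • ((1 - (W : Mat2))⁻¹ * (1 + (W : Mat2)))
  have hWH : (1 - (W : Mat2)) * H = Complex.I • (1 + (W : Mat2)) := by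
    rw [Matrix.mul_smul, Matrix.mul_nonsing_inv_cancel_left _ _ hminus]
  have hunit : IsUnit (1 - (W : Mat2)) := (Matrix.isUnit_iff_isUnit_det _).2 hminus
  have hH : H.IsHermitian := by
    have hadj : Hᴴ * (1 - (W : Mat2))ᴴ = -(Complex.I • (1 + (W : Mat2))ᴴ) := by
      rw [← Matrix.conjTranspose_mul, hWH, Matrix.conjTranspose_smul, ← neg_smul]
      rw [RCLike.star_def, Complex.conj_I]
    apply hunit.mul_right_injective
    apply ((Matrix.isUnit_conjTranspose _).2 hunit).mul_left_injective
    show (1 - (W : Mat2)) * Hᴴ * (1 - (W : Mat2))ᴴ = (1 - (W : Mat2)) * H * (1 - (W : Mat2))ᴴ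
    rw [Matrix.mul_assoc, hadj, hWH, Matrix.mul_neg, Matrix.mul_smul, Matrix.smul_mul, ← smul_neg]
    congr 1
    have hWW := mul_conjTranspose_self_of_U2 W
    simp only [Matrix.conjTranspose_sub, Matrix.conjTranspose_add, Matrix.conjTranspose_one,
      sub_mul, mul_sub, add_mul, mul_add, hWW, Matrix.mul_one, Matrix.one_mul]
    abel
  have hHdet : H.det ≠ 0 := by
    intro h
    have := congrArg Matrix.det hWH
    rw [Matrix.det_mul, h, mul_zero, Matrix.det_smul] at this
    simp [hplus] at this
  obtain ⟨X, Y, s, hs, hYX, hHX⟩ := exists_congruence_of_isHermitian hH hHdet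
  obtain ⟨Φ, hΦ, hΦA, hΦB, hmap⟩ := exists_isAut_of_frame A B (X := X) (Y := Y) (by
    rw [hA, hB, Matrix.conjTranspose_one, Matrix.one_mul, sub_neg_eq_add, mul_add, Matrix.mul_one,
      add_mul, hYX, one_add_one_eq_two])
  have hss : Matrix.diagonal s * Matrix.diagonal s = 1 := by
    rw [Matrix.diagonal_mul_diagonal, ← Matrix.diagonal_one]
    congr 1
    ext i
    rcases hs i with h | h <;> simp [h]
  have hWX : (1 + (W : Mat2)) * X =
      -(Complex.I • ((1 - (W : Mat2)) * Y * Matrix.diagonal s)) := by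
    rw [Matrix.mul_assoc, ← hHX, ← Matrix.mul_assoc, hWH, Matrix.smul_mul, smul_smul]
    simp
  let T : U2 := ⟨-(Complex.I • Matrix.diagonal s), neg_I_smul_diagonal_mem hs⟩
  have hT : (T : Mat2) = -(Complex.I • Matrix.diagonal s) := rfl
  have hΦT : Φ T = W := by
    apply hmap
    have hbal : (1 - (W : Mat2)) * Y * (1 + (T : Mat2)) =
        (1 + (W : Mat2)) * X * (1 - (T : Mat2)) := by
      rw [hWX, hT]
      generalize (1 - (W : Mat2)) * Y = Z
      simp only [sub_neg_eq_add, mul_add, Matrix.neg_mul, Matrix.mul_neg, Matrix.mul_one,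
        Matrix.mul_smul, Matrix.smul_mul, Matrix.mul_assoc, hss]
      match_scalars <;> simp
    rw [hA, hB, ← sub_eq_zero, ← neg_eq_zero, ← sub_eq_zero.2 hbal]
    noncomm_ring
  obtain ⟨Ψ, hΨ, hinv⟩ := hΦ.exists_inverse
  refine ⟨Ψ, s, hΨ, hs, ?_, ?_, ?_⟩
  · conv_lhs => rw [← hΦA A hA, hinv]
  · conv_lhs => rw [← hΦB B hB, hinv]
  · rw [← hΦT, hinv]

theorem exists_isAut_normal_form {A₁ A₂ A₃ : U2} (h12 : ¬ CoherentU A₁ A₂)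
    (h13 : ¬ CoherentU A₁ A₃) (h23 : ¬ CoherentU A₂ A₃) :
    ∃ Φ : U2 → U2, IsAut Φ ∧ (Φ A₁ : Mat2) = -1 ∧ (Φ A₂ : Mat2) = 1 ∧
      ((Φ A₃ : Mat2) = -(Complex.I • (1 : Mat2)) ∨ (Φ A₃ : Mat2) = -(Complex.I • Jmat)) := by
  obtain ⟨Φ, hΦ, h1, h2⟩ := exists_isAut_of_not_coherent h12
  obtain ⟨Ψ, s, hΨ, hs, hΨ1, hΨ2, hΨ3⟩ := exists_isAut_diagonal h1 h2
    (fun h => h13 ((hΦ.2 _ _).2 h)) (fun h => h23 ((hΦ.2 _ _).2 h))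
  have diagonal_cases {t : Fin 2 → ℂ} (h0 : t 0 = 1) (h1 : t 1 = 1 ∨ t 1 = -1) :
      Matrix.diagonal t = (1 : Mat2) ∨ Matrix.diagonal t = Jmat := by
    refine h1.imp (fun h1 => ?_) fun h1 => ?_
    · rw [← Matrix.diagonal_one]
      congr 1
      ext i
      fin_cases i <;> simp [h0, h1]
    · rw [Jmat]
      congr 1
      ext i
      fin_cases i <;> simp [h0, h1]
  rcases hs 0 with h0 | h0
  · refine ⟨Ψ ∘ Φ, hΨ.comp hΦ, by simp [hΨ1, h1], by simp [hΨ2, h2], ?_⟩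
    rw [Function.comp_apply, hΨ3]
    exact (diagonal_cases h0 (hs 1)).imp (by rintro h; rw [h]) (by rintro h; rw [h])
  · refine ⟨star ∘ Ψ ∘ Φ, isAut_star.comp (hΨ.comp hΦ), by simp [hΨ1, h1], by simp [hΨ2, h2], ?_⟩
    have hneg : ((star (Ψ (Φ A₃)) : U2) : Mat2) = -(Complex.I • Matrix.diagonal (-s)) := by
      rw [Unitary.coe_star, hΨ3, Matrix.star_eq_conjTranspose]
      ext i j
      fin_cases i <;> fin_cases j <;> rcases hs 1 with h1 | h1 <;> simp [h0, h1]
    rw [Function.comp_apply, Function.comp_apply, hneg]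
    refine (diagonal_cases (t := -s) (by simp [h0]) ?_).imp (by rintro h; rw [h])
      (by rintro h; rw [h])
    rcases hs 1 with h | h <;> simp [h]

/-- Some point is coherent to all three given points. -/
def HasCommonCoherent (A₁ A₂ A₃ : U2) : Prop :=
  ∃ W : U2, CoherentU W A₁ ∧ CoherentU W A₂ ∧ CoherentU W A₃

theorem IsAut.hasCommonCoherent_iff {Φ : U2 → U2} (hΦ : IsAut Φ) (A₁ A₂ A₃ : U2) :
    HasCommonCoherent (Φ A₁) (Φ A₂) (Φ A₃) ↔ HasCommonCoherent A₁ A₂ A₃ := by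
  unfold HasCommonCoherent
  rw [hΦ.1.surjective.exists]
  simp only [← hΦ.2]

theorem not_hasCommonCoherent_of_timelike {A₁ A₂ A₃ : U2} (h1 : (A₁ : Mat2) = -1)
    (h2 : (A₂ : Mat2) = 1) (h3 : (A₃ : Mat2) = -(Complex.I • (1 : Mat2))) :
    ¬ HasCommonCoherent A₁ A₂ A₃ := by
  rintro ⟨W, hW1, hW2, hW3⟩
  rw [coherentU_iff_det_eq_zero, Matrix.det_fin_two] at hW1 hW2 hW3
  simp [h1, h2, h3] at hW1 hW2 hW3
  have hI := Complex.I_mul_I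
  have : (2 : ℂ) = 0 := by
    linear_combination (1 + Complex.I) / 2 * hW1 + (1 - Complex.I) / 2 * hW2 - hW3 + hI
  norm_num at this

theorem hasCommonCoherent_of_spacelike {A₁ A₂ A₃ : U2} (h1 : (A₁ : Mat2) = -1)
    (h2 : (A₂ : Mat2) = 1) (h3 : (A₃ : Mat2) = -(Complex.I • Jmat)) :
    HasCommonCoherent A₁ A₂ A₃ := by
  refine ⟨⟨!![0, 1; 1, 0], ?_⟩, ?_, ?_, ?_⟩
  · rw [Matrix.mem_unitaryGroup_iff', Matrix.star_eq_conjTranspose]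
    ext i j
    fin_cases i <;> fin_cases j <;> simp [Matrix.mul_apply]
  · rw [coherentU_iff_det_eq_zero, h1, Matrix.det_fin_two]
    simp
  · rw [coherentU_iff_det_eq_zero, h2, Matrix.det_fin_two]
    simp
  · rw [coherentU_iff_det_eq_zero, h3, Matrix.det_fin_two]
    simp [Jmat]

/-- **Trichotomy for triples.**  Three pairwise non-coherent points of `U₂` are either in a
timelike position or in a spacelike position, and not both. -/
theorem timelike_or_spacelike
    (A₁ A₂ A₃ : U2)
    (h12 : ((A₁ : Mat2) - (A₂ : Mat2)).rank = 2)
    (h13 : ((A₁ : Mat2) - (A₃ : Mat2)).rank = 2)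
    (h23 : ((A₂ : Mat2) - (A₃ : Mat2)).rank = 2) :
    ((∃ Φ : U2 → U2, IsAut Φ ∧
        ((Φ A₁ : Mat2) = -(1 : Mat2)) ∧ ((Φ A₂ : Mat2) = (1 : Mat2)) ∧
        ((Φ A₃ : Mat2) = -(Complex.I • (1 : Mat2)))) ∧
      ¬ (∃ Φ : U2 → U2, IsAut Φ ∧
        ((Φ A₁ : Mat2) = -(1 : Mat2)) ∧ ((Φ A₂ : Mat2) = (1 : Mat2)) ∧
        ((Φ A₃ : Mat2) = -(Complex.I • Jmat)))) ∨
    ((∃ Φ : U2 → U2, IsAut Φ ∧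
        ((Φ A₁ : Mat2) = -(1 : Mat2)) ∧ ((Φ A₂ : Mat2) = (1 : Mat2)) ∧
        ((Φ A₃ : Mat2) = -(Complex.I • Jmat))) ∧
      ¬ (∃ Φ : U2 → U2, IsAut Φ ∧
        ((Φ A₁ : Mat2) = -(1 : Mat2)) ∧ ((Φ A₂ : Mat2) = (1 : Mat2)) ∧
        ((Φ A₃ : Mat2) = -(Complex.I • (1 : Mat2))))) := by
  obtain ⟨Φ, hΦ, h1, h2, h3⟩ := exists_isAut_normal_form (A₁ := A₁) (A₂ := A₂) (A₃ := A₃)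
    (by rw [CoherentU]; omega) (by rw [CoherentU]; omega) (by rw [CoherentU]; omega)
  rcases h3 with h3 | h3
  · refine Or.inl ⟨⟨Φ, hΦ, h1, h2, h3⟩, ?_⟩
    rintro ⟨Ψ, hΨ, g1, g2, g3⟩
    apply not_hasCommonCoherent_of_timelike h1 h2 h3
    rw [hΦ.hasCommonCoherent_iff, ← hΨ.hasCommonCoherent_iff]
    exact hasCommonCoherent_of_spacelike g1 g2 g3
  · refine Or.inr ⟨⟨Φ, hΦ, h1, h2, h3⟩, ?_⟩
    rintro ⟨Ψ, hΨ, g1, g2, g3⟩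
    apply not_hasCommonCoherent_of_timelike g1 g2 g3
    rw [hΨ.hasCommonCoherent_iff, ← hΦ.hasCommonCoherent_iff]
    exact hasCommonCoherent_of_spacelike h1 h2 h3
end
end

section
/- Let A, B, P ∈ H₂ satisfy A < B, rank(P − A) ≤ 1, and rank(P − B) ≤ 1, and let X ∈ H₂ with A ≤ X ≤ B. Then rank(X − P) ≤ 1 if and only if (A ≤ X and X ≤ P) or (P ≤ X and X ≤ B). -/
open Matrix
open scoped ComplexOrder

noncomputable section

/-- A square matrix of size two has rank at most one iff its determinant vanishes. -/
lemma rank_le_one_iff_det_eq_zero_s14 (M : Mat2) : M.rank ≤ 1 ↔ M.det = 0 := by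
  constructor
  · intro h
    by_contra hd
    have hrank := rank_of_det_ne_zero hd
    rw [Fintype.card_fin] at hrank
    omega
  · intro hd
    obtain ⟨v, hv, hMv⟩ := exists_mulVec_eq_zero_iff.2 hd
    have hker : M.mulVecLin.ker ≠ ⊥ := fun h =>
      hv ((Submodule.mem_bot ℂ).1 (h ▸ LinearMap.mem_ker.2 hMv))
    have hpos := Submodule.one_le_finrank_iff.2 hker
    have hsum := M.mulVecLin.finrank_range_add_finrank_ker
    simp only [Module.finrank_fintype_fun_eq_card, Fintype.card_fin] at hsum
    change Module.finrank ℂ M.mulVecLin.range ≤ 1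
    omega

/-- A singular hermitian `2×2` matrix with nonnegative trace is positive semidefinite. -/
lemma posSemidef_of_det_eq_zero_of_trace_nonneg {M : Mat2} (hM : M.IsHermitian)
    (hd : M.det = 0) (ht : 0 ≤ M.trace.re) : M.PosSemidef := by
  rw [hM.posSemidef_iff_eigenvalues_nonneg]
  rw [hM.det_eq_prod_eigenvalues, Fin.prod_univ_two] at hd
  rw [hM.trace_eq_sum_eigenvalues, Fin.sum_univ_two] at ht
  simp only [mul_eq_zero, Complex.coe_algebraMap, Complex.ofReal_eq_zero] at hd
  simp at ht
  intro i
  fin_cases i <;> rcases hd with h | h <;> simp_all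

/-- A singular hermitian `2×2` matrix is semidefinite of one sign or the other. -/
lemma posSemidef_or_neg_posSemidef {M : Mat2} (hM : M.IsHermitian) (hd : M.det = 0) :
    (-M).PosSemidef ∨ M.PosSemidef := by
  rcases le_total 0 M.trace.re with h | h
  · exact .inr (posSemidef_of_det_eq_zero_of_trace_nonneg hM hd h)
  · refine .inl (posSemidef_of_det_eq_zero_of_trace_nonneg hM.neg ?_ ?_)
    · simp [det_neg, hd]
    · simpa using h

/-- A positive semidefinite matrix dominated by a singular one is singular. -/
lemma det_eq_zero_of_posSemidef_sub {n : Type*} [Fintype n] [DecidableEq n]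
    {M N : Matrix n n ℂ} (hM : M.PosSemidef) (hNM : (N - M).PosSemidef) (hN : N.det = 0) : M.det = 0 := by
  obtain ⟨v, hv, hNv⟩ := exists_mulVec_eq_zero_iff.2 hN
  refine exists_mulVec_eq_zero_iff.1 ⟨v, hv, ?_⟩
  rw [← hM.dotProduct_mulVec_zero_iff]
  refine le_antisymm ?_ (hM.dotProduct_mulVec_nonneg v)
  have h := hNM.dotProduct_mulVec_nonneg v
  rwa [sub_mulVec, hNv, zero_sub, dotProduct_neg, neg_nonneg] at h

/-- For `A < B` and `P ∈ 𝒮_{A,B}`, a point `X ∈ [A, B]` is coherent to `P` iff `X ∈ [A, P]` or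
`X ∈ [P, B]`. -/
theorem interval_inter_cone
    (A B P : Mat2) (hA : A.IsHermitian) (hB : B.IsHermitian) (hP : P.IsHermitian)
    (hAB : (B - A).PosDef)
    (hPA : (P - A).rank ≤ 1) (hPB : (P - B).rank ≤ 1)
    (X : Mat2) (hXA : (X - A).PosSemidef) (hXB : (B - X).PosSemidef) :
    (X - P).rank ≤ 1 ↔
      ((X - A).PosSemidef ∧ (P - X).PosSemidef) ∨
      ((X - P).PosSemidef ∧ (B - X).PosSemidef) := by
  have hneg : -(X - P) = P - X := neg_sub X P
  rw [rank_le_one_iff_det_eq_zero_s14] at hPA hPB ⊢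
  constructor
  · intro hd
    have hX : X.IsHermitian := by simpa using hXA.isHermitian.add hA
    rcases posSemidef_or_neg_posSemidef (hX.sub hP) hd with h | h
    · exact .inl ⟨hXA, hneg ▸ h⟩
    · exact .inr ⟨h, hXB⟩
  · rintro (⟨-, h⟩ | ⟨h, -⟩)
    · have hd := det_eq_zero_of_posSemidef_sub h (by simpa using hXA) hPA
      rw [← hneg, det_neg] at hd
      simpa using hd
    · refine det_eq_zero_of_posSemidef_sub (N := B - P) h (by simpa using hXB) ?_
      rw [← neg_sub P B, det_neg, hPB, mul_zero]
end
end

section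
/- Let P, Q ∈ 𝒫 with P ≠ Q and let a, b be real numbers. Then: if a > 0 and b > 0, then aP + bQ is positive definite; if a < 0 and b < 0, then aP + bQ is negative definite; if a·b < 0, then aP + bQ is an invertible hermitian matrix with one positive and one negative eigenvalue (equivalently, det(aP + bQ) < 0). More generally, for any nonzero complex numbers a and b, the matrix aP + bQ is invertible. -/
open Matrix
open scoped ComplexOrder

noncomputable section

theorem IsProj1.det_eq_zero {P : Mat2} (hP : IsProj1 P) : P.det = 0 := by
  by_contra h
  have hrank := rank_of_isUnit P ((isUnit_iff_isUnit_det P).2 (isUnit_iff_ne_zero.2 h))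
  simp [hP.2.2] at hrank

theorem IsProj1.trace_eq_one {P : Mat2} (hP : IsProj1 P) : P.trace = 1 := by
  have hdet := hP.det_eq_zero
  have hmul : P.trace • P = P := by
    rw [det_fin_two] at hdet
    conv_rhs => rw [← hP.2.1]
    ext i j
    fin_cases i <;> fin_cases j <;> simp [trace_fin_two, Matrix.mul_apply] <;>
      first | ring1 | linear_combination hdet
  have hne : P ≠ 0 := by
    rintro rfl
    simpa using hP.2.2
  have hsub : (P.trace - 1) • P = 0 := by rw [sub_smul, hmul, one_smul, sub_self]
  exact sub_eq_zero.1 ((smul_eq_zero.1 hsub).resolve_right hne)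

theorem IsProj1.posSemidef {P : Mat2} (hP : IsProj1 P) : P.PosSemidef := by
  have h := posSemidef_conjTranspose_mul_self P
  rwa [hP.1.eq, hP.2.1] at h

/-- The constant is `(P₀₀ - Q₀₀)² + |P₀₁ - Q₀₁|²`. -/
theorem IsProj1.exists_pos_det_smul_add_smul {P Q : Mat2} (hP : IsProj1 P) (hQ : IsProj1 Q)
    (hPQ : P ≠ Q) :
    ∃ t : ℝ, 0 < t ∧ ∀ c d : ℂ, (c • P + d • Q).det = c * d * t := by
  have hPdet := hP.det_eq_zero
  have hQdet := hQ.det_eq_zero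
  have hPtr := hP.trace_eq_one
  have hQtr := hQ.trace_eq_one
  rw [det_fin_two] at hPdet hQdet
  rw [trace_fin_two] at hPtr hQtr
  have hP10 : P 1 0 = star (P 0 1) := (hP.1.apply 1 0).symm
  have hQ10 : Q 1 0 = star (Q 0 1) := (hQ.1.apply 1 0).symm
  have hP11 : P 1 1 = 1 - P 0 0 := by linear_combination hPtr
  have hQ11 : Q 1 1 = 1 - Q 0 0 := by linear_combination hQtr
  have hreal : star (P 0 0 - Q 0 0) = P 0 0 - Q 0 0 := by
    rw [star_sub, hP.1.apply, hQ.1.apply]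
  have ht : ((Complex.normSq (P 0 0 - Q 0 0) + Complex.normSq (P 0 1 - Q 0 1) : ℝ) : ℂ) =
      (P 0 0 - Q 0 0) ^ 2 + (P 0 1 - Q 0 1) * (P 1 0 - Q 1 0) := by
    rw [hP10, hQ10, ← star_sub, Complex.ofReal_add, ← Complex.mul_conj, ← Complex.mul_conj,
      starRingEnd_apply, starRingEnd_apply, hreal, sq]
  refine ⟨Complex.normSq (P 0 0 - Q 0 0) + Complex.normSq (P 0 1 - Q 0 1), ?_, fun c d => ?_⟩
  · by_contra! h
    have h00 := Complex.normSq_nonneg (P 0 0 - Q 0 0)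
    have h01 := Complex.normSq_nonneg (P 0 1 - Q 0 1)
    have e00 : P 0 0 = Q 0 0 :=
      sub_eq_zero.1 (Complex.normSq_eq_zero.1 (le_antisymm (by linarith) h00))
    have e01 : P 0 1 = Q 0 1 :=
      sub_eq_zero.1 (Complex.normSq_eq_zero.1 (le_antisymm (by linarith) h01))
    apply hPQ
    ext i j
    fin_cases i <;> fin_cases j <;> simp [e00, e01, hP10, hQ10, hP11, hQ11]
  · rw [ht, det_fin_two]
    simp only [Matrix.add_apply, Matrix.smul_apply, smul_eq_mul]
    rw [hP11] at hPdet ⊢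
    rw [hQ11] at hQdet ⊢
    linear_combination (c ^ 2 + c * d) * hPdet + (d ^ 2 + c * d) * hQdet

theorem IsProj1.posDef_smul_add_smul {P Q : Mat2} (hP : IsProj1 P) (hQ : IsProj1 Q)
    (hPQ : P ≠ Q) {a b : ℝ} (ha : 0 < a) (hb : 0 < b) :
    ((a : ℂ) • P + (b : ℂ) • Q).PosDef := by
  obtain ⟨t, ht, hdet⟩ := hP.exists_pos_det_smul_add_smul hQ hPQ
  have hpos : ((a : ℂ) • P + (b : ℂ) • Q).PosSemidef :=
    (hP.posSemidef.smul (Complex.zero_le_real.2 ha.le)).add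
      (hQ.posSemidef.smul (Complex.zero_le_real.2 hb.le))
  rw [hpos.posDef_iff_isUnit, isUnit_iff_isUnit_det, hdet, isUnit_iff_ne_zero]
  exact_mod_cast ne_of_gt (mul_pos (mul_pos ha hb) ht)

/-- For distinct rank-one projections `P ≠ Q` and reals `a, b`: `aP + bQ` is positive definite
if `a, b > 0`, negative definite if `a, b < 0`, and an invertible hermitian matrix with negative
determinant (one positive and one negative eigenvalue) if `ab < 0`.  More generally `aP + bQ`
is invertible for all nonzero complex `a, b`. -/
theorem aP_plus_bQ
    (P Q : Mat2) (hP : IsProj1 P) (hQ : IsProj1 Q) (hPQ : P ≠ Q) (a b : ℝ) :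
    (0 < a → 0 < b → ((a : ℂ) • P + (b : ℂ) • Q).PosDef) ∧
    (a < 0 → b < 0 → (-((a : ℂ) • P + (b : ℂ) • Q)).PosDef) ∧
    (a * b < 0 →
      ((a : ℂ) • P + (b : ℂ) • Q).IsHermitian ∧
      (((a : ℂ) • P + (b : ℂ) • Q).det).im = 0 ∧
      (((a : ℂ) • P + (b : ℂ) • Q).det).re < 0) ∧
    (∀ c d : ℂ, c ≠ 0 → d ≠ 0 → IsUnit (c • P + d • Q)) := by
  obtain ⟨t, ht, hdet⟩ := hP.exists_pos_det_smul_add_smul hQ hPQ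
  refine ⟨hP.posDef_smul_add_smul hQ hPQ, fun ha hb => ?_, fun hab => ?_, fun c d hc hd => ?_⟩
  · have h := hP.posDef_smul_add_smul hQ hPQ (neg_pos.2 ha) (neg_pos.2 hb)
    rwa [Complex.ofReal_neg, Complex.ofReal_neg, neg_smul, neg_smul, ← neg_add] at h
  · refine ⟨?_, ?_⟩
    · simp [IsHermitian, hP.1.eq, hQ.1.eq]
    · rw [hdet, ← Complex.ofReal_mul, ← Complex.ofReal_mul]
      exact ⟨Complex.ofReal_im _, mul_neg_of_neg_of_pos hab ht⟩
  · rw [isUnit_iff_isUnit_det, hdet, isUnit_iff_ne_zero]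
    exact mul_ne_zero (mul_ne_zero hc hd) (Complex.ofReal_ne_zero.2 ht.ne')
end
end

section
/- For every A ∈ H₂, the matrix A + iI is invertible, and 𝔠(A) = (A − iI)(A + iI)⁻¹ is a unitary matrix that does not have 1 as an eigenvalue. Moreover, for all A, B ∈ H₂: rank(A − B) ≤ 1 if and only if rank(𝔠(A) − 𝔠(B)) ≤ 1. -/
open Matrix
open scoped ComplexOrder

noncomputable section

namespace Matrix

variable {n : Type*} [Fintype n] [DecidableEq n] {A : Matrix n n ℂ}

lemma commute_add_I_sub_I (A : Matrix n n ℂ) :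
    Commute (A + Complex.I • (1 : Matrix n n ℂ)) (A - Complex.I • (1 : Matrix n n ℂ)) := by
  simp only [Commute, SemiconjBy, add_mul, mul_sub, sub_mul, mul_add, mul_one, one_mul,
    smul_mul_assoc, mul_smul_comm]
  module

lemma IsHermitian.isUnit_add_I_mul_sub_I (hA : A.IsHermitian) :
    IsUnit ((A + Complex.I • (1 : Matrix n n ℂ)) * (A - Complex.I • (1 : Matrix n n ℂ))) := by
  have h : (A + Complex.I • (1 : Matrix n n ℂ)) * (A - Complex.I • (1 : Matrix n n ℂ))
      = Aᴴ * A + 1 := by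
    simp [add_mul, mul_sub, smul_smul, hA.eq]
    abel
  rw [h]
  exact (PosDef.posSemidef_add (posSemidef_conjTranspose_mul_self A) PosDef.one).isUnit

lemma IsHermitian.isUnit_add_I (hA : A.IsHermitian) : IsUnit (A + Complex.I • (1 : Matrix n n ℂ)) :=
  ((commute_add_I_sub_I A).isUnit_mul_iff.mp hA.isUnit_add_I_mul_sub_I).1

lemma IsHermitian.isUnit_sub_I (hA : A.IsHermitian) : IsUnit (A - Complex.I • (1 : Matrix n n ℂ)) :=
  ((commute_add_I_sub_I A).isUnit_mul_iff.mp hA.isUnit_add_I_mul_sub_I).2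

end Matrix

lemma cayleyMat_eq_one_sub {A : Mat2} (hA : A.IsHermitian) :
    cayleyMat A = 1 - (2 * Complex.I) • (A + Complex.I • (1 : Mat2))⁻¹ := by
  have h : A - Complex.I • (1 : Mat2)
      = (A + Complex.I • (1 : Mat2)) - (2 * Complex.I) • (1 : Mat2) := by
    module
  rw [cayleyMat, h, sub_mul, mul_nonsing_inv _ ((isUnit_iff_isUnit_det _).mp hA.isUnit_add_I),
    smul_mul_assoc, one_mul]

lemma cayleyMat_mem_unitaryGroup {A : Mat2} (hA : A.IsHermitian) :
    cayleyMat A ∈ Matrix.unitaryGroup (Fin 2) ℂ := by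
  rw [mem_unitaryGroup_iff, star_eq_conjTranspose, cayleyMat, conjTranspose_mul,
    conjTranspose_nonsing_inv]
  have hadd : (A + Complex.I • (1 : Mat2))ᴴ = A - Complex.I • (1 : Mat2) := by
    simp [hA.eq, sub_eq_add_neg]
  have hsub : (A - Complex.I • (1 : Mat2))ᴴ = A + Complex.I • (1 : Mat2) := by
    simp [hA.eq]
  have hcomm := (commute_add_I_sub_I A).eq
  have hM := (isUnit_iff_isUnit_det _).mp hA.isUnit_add_I
  have hL := (isUnit_iff_isUnit_det _).mp hA.isUnit_sub_I
  rw [hadd, hsub]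
  generalize A + Complex.I • (1 : Mat2) = M at *
  generalize A - Complex.I • (1 : Mat2) = L at *
  calc L * M⁻¹ * (L⁻¹ * M) = L * (M⁻¹ * L⁻¹) * M := by simp only [mul_assoc]
    _ = L * (L⁻¹ * M⁻¹) * M := by rw [← Matrix.mul_inv_rev, ← Matrix.mul_inv_rev, hcomm]
    _ = 1 := by rw [← mul_assoc, mul_nonsing_inv _ hL, one_mul, nonsing_inv_mul _ hM]

lemma isUnit_two_I_smul_inv {A : Mat2} (hA : A.IsHermitian) :
    IsUnit ((2 * Complex.I) • (A + Complex.I • (1 : Mat2))⁻¹) :=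
  (isUnit_nonsing_inv_iff.mpr hA.isUnit_add_I).smul
    (Units.mk0 (2 * Complex.I) (by simp))

lemma one_notMem_spectrum_cayleyMat {A : Mat2} (hA : A.IsHermitian) :
    (1 : ℂ) ∉ spectrum ℂ (cayleyMat A) := by
  rw [spectrum.notMem_iff, cayleyMat_eq_one_sub hA, map_one, sub_sub_cancel]
  exact isUnit_two_I_smul_inv hA

lemma rank_cayleyMat_sub {A B : Mat2} (hA : A.IsHermitian) (hB : B.IsHermitian) :
    (cayleyMat A - cayleyMat B).rank = (A - B).rank := by
  have hM := (isUnit_iff_isUnit_det _).mp hA.isUnit_add_I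
  have hN := (isUnit_iff_isUnit_det _).mp hB.isUnit_add_I
  have h : cayleyMat A - cayleyMat B = ((2 * Complex.I) • (A + Complex.I • (1 : Mat2))⁻¹)
      * (A - B) * (B + Complex.I • (1 : Mat2))⁻¹ := by
    have hAB : A - B = (A + Complex.I • (1 : Mat2)) - (B + Complex.I • (1 : Mat2)) := by abel
    rw [cayleyMat_eq_one_sub hA, cayleyMat_eq_one_sub hB, hAB, mul_sub, sub_mul,
      smul_mul_assoc, nonsing_inv_mul _ hM, smul_mul_assoc, one_mul, smul_mul_assoc,
      smul_mul_assoc, mul_assoc, mul_nonsing_inv _ hN, mul_one]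
    abel
  rw [h, rank_mul_eq_left_of_isUnit_det _ _ (by simpa using hN),
    rank_mul_eq_right_of_isUnit_det _ _ ((isUnit_iff_isUnit_det _).mp (isUnit_two_I_smul_inv hA))]

/-- For hermitian `A`, `A + iI` is invertible and the Cayley transform `𝔠(A)` is unitary
without `1` in its spectrum; moreover `𝔠` preserves coherency in both directions on `H₂`. -/
theorem cayley_transform_properties :
    (∀ A : Mat2, A.IsHermitian →
      IsUnit (A + Complex.I • (1 : Mat2)) ∧
      cayleyMat A ∈ Matrix.unitaryGroup (Fin 2) ℂ ∧
      (1 : ℂ) ∉ spectrum ℂ (cayleyMat A)) ∧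
    (∀ A B : Mat2, A.IsHermitian → B.IsHermitian →
      ((A - B).rank ≤ 1 ↔ (cayleyMat A - cayleyMat B).rank ≤ 1)) := by
  refine ⟨fun A hA => ⟨hA.isUnit_add_I, cayleyMat_mem_unitaryGroup hA,
    one_notMem_spectrum_cayleyMat hA⟩, fun A B hA hB => ?_⟩
  rw [rank_cayleyMat_sub hA hB]
end
end
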